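/- arXiv:0710.2007 — 3 statements merged into one kernel-verified Lean document; each statement's English description precedes it below -/
import Mathlib

section
/- Let U ⊆ ℝ × ℝ³ be open, write points of U as (t,x) with x ∈ ℝ³, and set Σ := {x ∈ ℝ³ : (0,x) ∈ U}, assumed nonempty and open. For ε ∈ (0,1] let V_ε > 0, N^i_ε (i = 1,2,3), h^{ij}_ε (i,j = 1,2,3, symmetric in i,j) and b^c_ε (c = 0,1,2,3) be smooth real-valued functions on U satisfying: (i) for every compact K ⊂ U, sup_K |V_ε|, sup_K |N^i_ε|, sup_K |h^{ij}_ε| are O(1) as ε → 0⁺; (ii) for every compact K ⊂ U and every first-order partial derivative ∂_a, sup_K |∂_a V_ε| = O(1); (iii) for every compact K ⊂ U and every multi-index α, sup_K |∂^α V_ε|, sup_K |∂^α N^i_ε|, sup_K |∂^α h^{ij}_ε| are O(ε^{-|α|}) and sup_K |∂^α b^c_ε| = O(ε^{-1-|α|}); (iv) for every compact K ⊂ U there exist M₀ ≥ 1 and ε₀ > 0 with 1/M₀ ≤ V_ε ≤ M₀ on K for all ε < ε₀. Let (f_ε)_ε be a moderate net of smooth functions on U, and for each ε let u_ε be a smooth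 solution on U of −V_ε^{-2} ∂_t² u_ε − 2 V_ε^{-2} N^i_ε ∂_t ∂_i u_ε + (h^{ij}_ε − V_ε^{-2} N^i_ε N^j_ε) ∂_i ∂_j u_ε + b^c_ε ∂_c u_ε = f_ε (summation over repeated indices), with initial data u_ε(0,x) = v_ε(x) and ∂_t u_ε(0,x) = w_ε(x) for x ∈ Σ. If (v_ε)_ε and (w_ε)_ε are moderate nets of smooth functions on Σ, then for every s ∈ ℕ and every multi-index β in the spatial variables, the net of traces ((∂_t^s ∂_x^β u_ε)(0,·))_ε is a moderate net of smooth functions on Σ. If moreover (v_ε)_ε, (w_ε)_ε and (f_ε)_ε are negligible, then each net ((∂_t^s ∂_x^β u_ε)(0,·))_ε is negligible. -/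
open Set

/-- Partial derivative in the `i`-th coordinate direction. -/
noncomputable def pd {n : ℕ} (i : Fin n) (f : (Fin n → ℝ) → ℝ) : (Fin n → ℝ) → ℝ :=
  fun x => fderiv ℝ f x (Pi.single i 1)

/-- Iterated partial derivative along the multi-index `α` (a list of coordinate directions). -/
noncomputable def pds {n : ℕ} (α : List (Fin n)) (f : (Fin n → ℝ) → ℝ) : (Fin n → ℝ) → ℝ :=
  α.foldr pd f

/-- Embedding of a spatial point `x ∈ ℝ³` as the space-time point `(0, x) ∈ ℝ × ℝ³ = ℝ⁴`. -/
def timeZero (x : Fin 3 → ℝ) : Fin 4 → ℝ := Fin.cons 0 x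

/-- A net of smooth functions on the open set `Ω` is moderate. -/
def ModerateOn {n : ℕ} (Ω : Set (Fin n → ℝ)) (u : ℝ → (Fin n → ℝ) → ℝ) : Prop :=
  ∀ K ⊆ Ω, IsCompact K → ∀ α : List (Fin n), ∃ N : ℕ, ∃ C > (0:ℝ), ∃ ε₀ > (0:ℝ),
    ∀ ε : ℝ, 0 < ε → ε < ε₀ → ∀ x ∈ K, |pds α (u ε) x| ≤ C * ε⁻¹ ^ N

/-- A net of smooth functions on the open set `Ω` is negligible. -/
def NegligibleOn {n : ℕ} (Ω : Set (Fin n → ℝ)) (u : ℝ → (Fin n → ℝ) → ℝ) : Prop :=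
  ∀ K ⊆ Ω, IsCompact K → ∀ α : List (Fin n), ∀ q : ℕ, ∃ C > (0:ℝ), ∃ ε₀ > (0:ℝ),
    ∀ ε : ℝ, 0 < ε → ε < ε₀ → ∀ x ∈ K, |pds α (u ε) x| ≤ C * ε ^ q

/-! ### Calculus of coordinate partial derivatives on open sets -/

section PartialDerivatives

variable {n : ℕ} {U : Set (Fin n → ℝ)} {f g : (Fin n → ℝ) → ℝ}

lemma pds_cons (i : Fin n) (α : List (Fin n)) (f : (Fin n → ℝ) → ℝ) :
    pds (i :: α) f = pd i (pds α f) := rfl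

lemma pds_singleton (i : Fin n) (f : (Fin n → ℝ) → ℝ) : pds [i] f = pd i f := rfl

lemma pds_append (α β : List (Fin n)) (f : (Fin n → ℝ) → ℝ) :
    pds (α ++ β) f = pds α (pds β f) := by
  simp [pds, List.foldr_append]

lemma pd_congr (hU : IsOpen U) (hfg : EqOn f g U) (i : Fin n) : EqOn (pd i f) (pd i g) U := by
  intro x hx
  have : f =ᶠ[nhds x] g := hfg.eventuallyEq_of_mem (hU.mem_nhds hx)
  simp only [pd, this.fderiv_eq]

lemma pds_congr (hU : IsOpen U) (hfg : EqOn f g U) (α : List (Fin n)) :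
    EqOn (pds α f) (pds α g) U := by
  induction α with
  | nil => exact hfg
  | cons i α ih => exact pd_congr hU ih i

lemma differentiableAt_of_contDiffOn_top (hU : IsOpen U) (hf : ContDiffOn ℝ (⊤ : ℕ∞) f U)
    {x : Fin n → ℝ} (hx : x ∈ U) : DifferentiableAt ℝ f x :=
  (hf.contDiffAt (hU.mem_nhds hx)).differentiableAt (by simp)

lemma ContDiffOn.pd (hU : IsOpen U) (hf : ContDiffOn ℝ (⊤ : ℕ∞) f U) (i : Fin n) :
    ContDiffOn ℝ (⊤ : ℕ∞) (pd i f) U :=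
  (hf.fderiv_of_isOpen hU (m := (⊤ : ℕ∞)) (by simp)).clm_apply contDiffOn_const

lemma ContDiffOn.pds (hU : IsOpen U) (hf : ContDiffOn ℝ (⊤ : ℕ∞) f U) (α : List (Fin n)) :
    ContDiffOn ℝ (⊤ : ℕ∞) (pds α f) U := by
  induction α with
  | nil => exact hf
  | cons i α ih => exact ih.pd hU i

lemma pd_add (hU : IsOpen U) (hf : ContDiffOn ℝ (⊤ : ℕ∞) f U)
    (hg : ContDiffOn ℝ (⊤ : ℕ∞) g U) (i : Fin n) :
    EqOn (pd i (fun x => f x + g x)) (fun x => pd i f x + pd i g x) U := by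
  intro x hx
  simp only [pd]
  rw [fderiv_fun_add (differentiableAt_of_contDiffOn_top hU hf hx)
    (differentiableAt_of_contDiffOn_top hU hg hx)]
  rfl

lemma pd_mul (hU : IsOpen U) (hf : ContDiffOn ℝ (⊤ : ℕ∞) f U)
    (hg : ContDiffOn ℝ (⊤ : ℕ∞) g U) (i : Fin n) :
    EqOn (pd i (fun x => f x * g x)) (fun x => pd i f x * g x + f x * pd i g x) U := by
  intro x hx
  simp only [pd]
  rw [fderiv_fun_mul (differentiableAt_of_contDiffOn_top hU hf hx)
    (differentiableAt_of_contDiffOn_top hU hg hx)]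
  simp only [add_apply, smul_apply, smul_eq_mul]
  ring

lemma pds_add (hU : IsOpen U) (hf : ContDiffOn ℝ (⊤ : ℕ∞) f U)
    (hg : ContDiffOn ℝ (⊤ : ℕ∞) g U) (α : List (Fin n)) :
    EqOn (pds α (fun x => f x + g x)) (fun x => pds α f x + pds α g x) U := by
  induction α with
  | nil => exact fun x _ => rfl
  | cons i α ih => exact (pd_congr hU ih i).trans (pd_add hU (hf.pds hU α) (hg.pds hU α) i)

lemma pd_comm (hU : IsOpen U) (hf : ContDiffOn ℝ (⊤ : ℕ∞) f U) (i j : Fin n) :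
    EqOn (pd i (pd j f)) (pd j (pd i f)) U := by
  intro x hx
  have hfx : ContDiffAt ℝ (⊤ : ℕ∞) f x := hf.contDiffAt (hU.mem_nhds hx)
  have hd : DifferentiableAt ℝ (fderiv ℝ f) x :=
    (hfx.fderiv_right (m := (⊤ : ℕ∞)) (by simp)).differentiableAt (by simp)
  have hsymm : IsSymmSndFDerivAt ℝ f x :=
    hfx.isSymmSndFDerivAt (by
      rw [minSmoothness_of_isRCLikeNormedField]; exact WithTop.coe_le_coe.2 le_top)
  have key : ∀ k l : Fin n, pd k (pd l f) x
      = fderiv ℝ (fderiv ℝ f) x (Pi.single k 1) (Pi.single l 1) := by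
    intro k l
    unfold pd
    rw [fderiv_clm_apply hd (differentiableAt_const _)]
    simp
  rw [key, key]
  exact hsymm _ _

lemma pds_perm (hU : IsOpen U) (hf : ContDiffOn ℝ (⊤ : ℕ∞) f U) {α β : List (Fin n)}
    (hαβ : α.Perm β) : EqOn (pds α f) (pds β f) U := by
  induction hαβ with
  | nil => exact fun x _ => rfl
  | cons i _ ih => exact pd_congr hU ih i
  | swap i j l => exact pd_comm hU (hf.pds hU l) j i
  | trans _ _ ih₁ ih₂ => exact ih₁.trans ih₂

lemma pd_const (i : Fin n) (c : ℝ) : pd i (fun _ : Fin n → ℝ => c) = fun _ => 0 := by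
  funext x
  simp [pd]

end PartialDerivatives

/-! ### Restriction to the initial surface -/

lemma hasFDerivAt_timeZero (x : Fin 3 → ℝ) :
    ∃ L : (Fin 3 → ℝ) →L[ℝ] (Fin 4 → ℝ), HasFDerivAt timeZero L x ∧
      ∀ i, L (Pi.single i 1) = Pi.single i.succ 1 := by
  let T : (Fin 3 → ℝ) →ₗ[ℝ] (Fin 4 → ℝ) :=
    { toFun := timeZero
      map_add' := by
        intro a b
        funext k
        refine Fin.cases ?_ (fun k => ?_) k <;> simp [timeZero]
      map_smul' := by
        intro c a
        funext k
        refine Fin.cases ?_ (fun k => ?_) k <;> simp [timeZero] }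
  refine ⟨T.toContinuousLinearMap, T.toContinuousLinearMap.hasFDerivAt, fun i => ?_⟩
  change timeZero (Pi.single i 1) = _
  funext k
  refine Fin.cases ?_ (fun k => ?_) k <;> simp [timeZero, Pi.single_apply]

lemma continuous_timeZero : Continuous timeZero :=
  continuous_iff_continuousAt.2 fun x =>
    let ⟨_, hL, _⟩ := hasFDerivAt_timeZero x
    hL.continuousAt

lemma pds_comp_timeZero {U : Set (Fin 4 → ℝ)} (hU : IsOpen U) {g : (Fin 4 → ℝ) → ℝ}
    (hg : ContDiffOn ℝ (⊤ : ℕ∞) g U) (β : List (Fin 3)) :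
    EqOn (pds β (fun x => g (timeZero x))) (fun x => pds (β.map Fin.succ) g (timeZero x))
      (timeZero ⁻¹' U) := by
  induction β with
  | nil => exact fun x _ => rfl
  | cons i β ih =>
    refine (pd_congr (hU.preimage continuous_timeZero) ih i).trans fun x hx => ?_
    obtain ⟨L, hL, hLi⟩ := hasFDerivAt_timeZero x
    have hd := (differentiableAt_of_contDiffOn_top hU (hg.pds hU (β.map Fin.succ)) hx).hasFDerivAt
    have hcomp := hd.comp x hL
    simp only [List.map_cons, pds_cons, pd]
    rw [show (fun x => pds (β.map Fin.succ) g (timeZero x))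
      = pds (β.map Fin.succ) g ∘ timeZero from rfl, hcomp.fderiv]
    simp [hLi]

/-! ### Asymptotic classes of nets -/

/-- The net `g` is of moderate growth, uniformly on `E`. -/
def ModerateBound {X : Type*} (E : Set X) (g : ℝ → X → ℝ) : Prop :=
  ∃ N : ℕ, ∃ C > (0:ℝ), ∃ ε₀ > (0:ℝ), ∀ ε : ℝ, 0 < ε → ε < ε₀ → ∀ x ∈ E, |g ε x| ≤ C * ε⁻¹ ^ N

/-- The net `g` is of rapid decay, uniformly on `E`. -/
def NegligibleBound {X : Type*} (E : Set X) (g : ℝ → X → ℝ) : Prop :=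
  ∀ q : ℕ, ∃ C > (0:ℝ), ∃ ε₀ > (0:ℝ), ∀ ε : ℝ, 0 < ε → ε < ε₀ → ∀ x ∈ E, |g ε x| ≤ C * ε ^ q

/-- A class of nets on `E` that is a module over the nets of moderate growth. -/
structure IsModerateModule {X : Type*} (E : Set X) (Q : (ℝ → X → ℝ) → Prop) : Prop where
  congr : ∀ {g g' : ℝ → X → ℝ}, (∀ ε ∈ Ioc (0:ℝ) 1, ∀ x ∈ E, g ε x = g' ε x) → Q g → Q g'
  zero : Q fun _ _ => 0
  add : ∀ {g g' : ℝ → X → ℝ}, Q g → Q g' → Q fun ε x => g ε x + g' ε x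
  mul : ∀ {a g : ℝ → X → ℝ}, ModerateBound E a → Q g → Q fun ε x => a ε x * g ε x

lemma isModerateModule_moderateBound {X : Type*} (E : Set X) :
    IsModerateModule E (ModerateBound E) where
  congr := by
    rintro g g' hgg' ⟨N, C, hC, ε₀, hε₀, hb⟩
    refine ⟨N, C, hC, min ε₀ 1, by positivity, fun ε h0 h1 x hx => ?_⟩
    rw [← hgg' ε ⟨h0, (h1.trans_le (min_le_right _ _)).le⟩ x hx]
    exact hb ε h0 (h1.trans_le (min_le_left _ _)) x hx
  zero := ⟨0, 1, one_pos, 1, one_pos, fun ε _ _ x _ => by simp⟩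
  add := by
    rintro g g' ⟨N, C, hC, ε₀, hε₀, hb⟩ ⟨N', C', hC', ε₀', hε₀', hb'⟩
    refine ⟨N + N', C + C', by positivity, min (min ε₀ ε₀') 1, by positivity,
      fun ε h0 h1 x hx => ?_⟩
    obtain ⟨h12, h3⟩ := lt_min_iff.1 h1
    obtain ⟨h1, h2⟩ := lt_min_iff.1 h12
    have hone : 1 ≤ ε⁻¹ := (one_le_inv₀ h0).2 h3.le
    calc |g ε x + g' ε x| ≤ |g ε x| + |g' ε x| := abs_add_le _ _
      _ ≤ C * ε⁻¹ ^ N + C' * ε⁻¹ ^ N' := add_le_add (hb ε h0 h1 x hx) (hb' ε h0 h2 x hx)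
      _ ≤ C * ε⁻¹ ^ (N + N') + C' * ε⁻¹ ^ (N + N') := by
          gcongr <;> first | exact hone | omega
      _ = (C + C') * ε⁻¹ ^ (N + N') := by ring
  mul := by
    rintro a g ⟨N, C, hC, ε₀, hε₀, hb⟩ ⟨N', C', hC', ε₀', hε₀', hb'⟩
    refine ⟨N + N', C * C', by positivity, min ε₀ ε₀', by positivity, fun ε h0 h1 x hx => ?_⟩
    obtain ⟨h1, h2⟩ := lt_min_iff.1 h1
    calc |a ε x * g ε x| = |a ε x| * |g ε x| := abs_mul _ _
      _ ≤ (C * ε⁻¹ ^ N) * (C' * ε⁻¹ ^ N') :=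
          mul_le_mul (hb ε h0 h1 x hx) (hb' ε h0 h2 x hx) (abs_nonneg _) (by positivity)
      _ = C * C' * ε⁻¹ ^ (N + N') := by ring

lemma isModerateModule_negligibleBound {X : Type*} (E : Set X) :
    IsModerateModule E (NegligibleBound E) where
  congr := by
    intro g g' hgg' hg q
    obtain ⟨C, hC, ε₀, hε₀, hb⟩ := hg q
    refine ⟨C, hC, min ε₀ 1, by positivity, fun ε h0 h1 x hx => ?_⟩
    rw [← hgg' ε ⟨h0, (h1.trans_le (min_le_right _ _)).le⟩ x hx]
    exact hb ε h0 (h1.trans_le (min_le_left _ _)) x hx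
  zero := fun q => ⟨1, one_pos, 1, one_pos, fun ε h0 _ x _ => by simpa using by positivity⟩
  add := by
    intro g g' hg hg' q
    obtain ⟨C, hC, ε₀, hε₀, hb⟩ := hg q
    obtain ⟨C', hC', ε₀', hε₀', hb'⟩ := hg' q
    refine ⟨C + C', by positivity, min ε₀ ε₀', by positivity, fun ε h0 h1 x hx => ?_⟩
    obtain ⟨h1, h2⟩ := lt_min_iff.1 h1
    calc |g ε x + g' ε x| ≤ |g ε x| + |g' ε x| := abs_add_le _ _
      _ ≤ C * ε ^ q + C' * ε ^ q := add_le_add (hb ε h0 h1 x hx) (hb' ε h0 h2 x hx)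
      _ = (C + C') * ε ^ q := by ring
  mul := by
    rintro a g ⟨N, C, hC, ε₀, hε₀, hb⟩ hg q
    obtain ⟨C', hC', ε₀', hε₀', hb'⟩ := hg (N + q)
    refine ⟨C * C', by positivity, min ε₀ ε₀', by positivity, fun ε h0 h1 x hx => ?_⟩
    obtain ⟨h1, h2⟩ := lt_min_iff.1 h1
    calc |a ε x * g ε x| = |a ε x| * |g ε x| := abs_mul _ _
      _ ≤ (C * ε⁻¹ ^ N) * (C' * ε ^ (N + q)) :=
          mul_le_mul (hb ε h0 h1 x hx) (hb' ε h0 h2 x hx) (abs_nonneg _) (by positivity)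
      _ = C * C' * ε ^ q := by
          rw [pow_add, inv_pow]
          field_simp

/-- The net `g` is smooth on `U`, and all its partial derivatives involving at most `s` time
derivatives belong to the class `Q`. -/
def BoundedToTimeOrder (U : Set (Fin 4 → ℝ)) (Q : (ℝ → (Fin 4 → ℝ) → ℝ) → Prop) (s : ℕ)
    (g : ℝ → (Fin 4 → ℝ) → ℝ) : Prop :=
  (∀ ε ∈ Ioc (0:ℝ) 1, ContDiffOn ℝ (⊤ : ℕ∞) (g ε) U) ∧
    ∀ α : List (Fin 4), α.count 0 ≤ s → Q fun ε => pds α (g ε)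

namespace BoundedToTimeOrder

variable {U E : Set (Fin 4 → ℝ)} {Q : (ℝ → (Fin 4 → ℝ) → ℝ) → Prop} {s : ℕ}
  {a g g' : ℝ → (Fin 4 → ℝ) → ℝ}

lemma add (hU : IsOpen U) (hE : E ⊆ U) (hQ : IsModerateModule E Q)
    (hg : BoundedToTimeOrder U Q s g) (hg' : BoundedToTimeOrder U Q s g') :
    BoundedToTimeOrder U Q s fun ε x => g ε x + g' ε x := by
  refine ⟨fun ε hε => (hg.1 ε hε).add (hg'.1 ε hε), fun α hα => ?_⟩
  exact hQ.congr (fun ε hε x hx => (pds_add hU (hg.1 ε hε) (hg'.1 ε hε) α (hE hx)).symm)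
    (hQ.add (hg.2 α hα) (hg'.2 α hα))

lemma const (hQ : IsModerateModule E Q) (c : ℝ) (hc : Q fun _ _ => c) :
    BoundedToTimeOrder U Q s fun _ _ => c := by
  refine ⟨fun ε _ => contDiffOn_const, fun α _ => ?_⟩
  rcases List.eq_nil_or_concat α with rfl | ⟨α, i, rfl⟩
  · exact hc
  · have hz : ∀ β : List (Fin 4), pds β (fun _ : Fin 4 → ℝ => (0:ℝ)) = fun _ => 0 := by
      intro β
      induction β with
      | nil => rfl
      | cons j β ih => rw [pds_cons, ih, pd_const]
    simp only [List.concat_eq_append, pds_append]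
    have : pds [i] (fun _ : Fin 4 → ℝ => c) = fun _ => 0 := pd_const i c
    simp only [this, hz]
    exact hQ.zero

lemma sum {ι : Type*} (hU : IsOpen U) (hE : E ⊆ U) (hQ : IsModerateModule E Q) (t : Finset ι)
    {G : ι → ℝ → (Fin 4 → ℝ) → ℝ} (hG : ∀ i, BoundedToTimeOrder U Q s (G i)) :
    BoundedToTimeOrder U Q s fun ε x => ∑ i ∈ t, G i ε x := by
  classical
  induction t using Finset.induction_on with
  | empty => simpa using const hQ 0 hQ.zero
  | insert i t hi ih =>
    simp only [Finset.sum_insert hi]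
    exact add hU hE hQ (hG i) ih

lemma pds_mul_mem (hU : IsOpen U) (hE : E ⊆ U) (hQ : IsModerateModule E Q) (α : List (Fin 4)) :
    ∀ {a g : ℝ → (Fin 4 → ℝ) → ℝ}, (∀ s, BoundedToTimeOrder U (ModerateBound E) s a) →
      BoundedToTimeOrder U Q (α.count 0) g → Q fun ε => pds α fun x => a ε x * g ε x := by
  induction α using List.reverseRecOn with
  | nil => exact fun ha hg => hQ.mul ((ha 0).2 [] (by simp)) (hg.2 [] (by simp))
  | append_singleton α i ih =>
    intro a g ha hg
    have hai : ∀ s, BoundedToTimeOrder U (ModerateBound E) s fun ε => pd i (a ε) := fun s =>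
      ⟨fun ε hε => ((ha 0).1 ε hε).pd hU i, fun β _ => by
        have := (ha _).2 (β ++ [i]) le_rfl
        simpa only [pds_append, pds_singleton] using this⟩
    have hg₀ : BoundedToTimeOrder U Q (α.count 0) g :=
      ⟨hg.1, fun β hβ => hg.2 β (hβ.trans (by simp))⟩
    have hgi : BoundedToTimeOrder U Q (α.count 0) fun ε => pd i (g ε) :=
      ⟨fun ε hε => (hg.1 ε hε).pd hU i, fun β hβ => by
        have := hg.2 (β ++ [i]) (by simpa [List.count_append] using hβ)
        simpa only [pds_append, pds_singleton] using this⟩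
    refine hQ.congr (fun ε hε x hx => ?_) (hQ.add (ih hai hg₀) (ih ha hgi))
    have hsa := (ha 0).1 ε hε
    have hsg := hg.1 ε hε
    rw [pds_append]
    refine Eq.symm ((pds_congr hU (pd_mul hU hsa hsg i) α (hE hx)).trans ?_)
    exact pds_add hU ((hsa.pd hU i).mul hsg) (hsa.mul (hsg.pd hU i)) α (hE hx)

lemma mul (hU : IsOpen U) (hE : E ⊆ U) (hQ : IsModerateModule E Q)
    (ha : ∀ s, BoundedToTimeOrder U (ModerateBound E) s a) (hg : BoundedToTimeOrder U Q s g) :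
    BoundedToTimeOrder U Q s fun ε x => a ε x * g ε x :=
  ⟨fun ε hε => ((ha 0).1 ε hε).mul (hg.1 ε hε), fun α hα =>
    pds_mul_mem hU hE hQ α ha ⟨hg.1, fun β hβ => hg.2 β (hβ.trans hα)⟩⟩

lemma pd_succ (hU : IsOpen U) (hg : BoundedToTimeOrder U Q s g) (i : Fin 3) :
    BoundedToTimeOrder U Q s fun ε => pd i.succ (g ε) :=
  ⟨fun ε hε => (hg.1 ε hε).pd hU _, fun β hβ => by
    have := hg.2 (β ++ [i.succ]) (by simpa [List.count_append] using hβ)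
    simpa only [pds_append, pds_singleton] using this⟩

lemma pd_zero (hU : IsOpen U) (hg : BoundedToTimeOrder U Q (s + 1) g) :
    BoundedToTimeOrder U Q s fun ε => pd 0 (g ε) :=
  ⟨fun ε hε => (hg.1 ε hε).pd hU _, fun β hβ => by
    have := hg.2 (β ++ [0]) (by simpa [List.count_append] using hβ)
    simpa only [pds_append, pds_singleton] using this⟩

lemma of_le {s' : ℕ} (hs : s' ≤ s) (hg : BoundedToTimeOrder U Q s g) :
    BoundedToTimeOrder U Q s' g :=
  ⟨hg.1, fun α hα => hg.2 α (hα.trans hs)⟩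

/-- It suffices to bound one more time derivative applied innermost. -/
lemma succ_of_pd_zero (hU : IsOpen U) (hE : E ⊆ U) (hQ : IsModerateModule E Q)
    (hg : BoundedToTimeOrder U Q 0 g) (hg₀ : BoundedToTimeOrder U Q s fun ε => pd 0 (g ε)) :
    BoundedToTimeOrder U Q (s + 1) g := by
  refine ⟨hg.1, fun α hα => ?_⟩
  by_cases h0 : (0 : Fin 4) ∈ α
  · have hperm : α.Perm (α.erase 0 ++ [0]) :=
      (List.perm_cons_erase h0).trans (List.perm_append_singleton _ _).symm
    have hcount : (α.erase 0).count 0 ≤ s := by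
      rw [List.count_erase_self]
      omega
    refine hQ.congr (fun ε hε x hx => ?_) (hg₀.2 _ hcount)
    rw [pds_perm hU (hg.1 ε hε) hperm (hE hx), pds_append]
    rfl
  · exact hg.2 α (List.count_eq_zero.2 h0).le

end BoundedToTimeOrder

lemma exists_map_succ_of_zero_notMem {n : ℕ} (α : List (Fin (n + 1))) (h0 : 0 ∉ α) :
    ∃ β : List (Fin n), β.map Fin.succ = α := by
  induction α with
  | nil => exact ⟨[], rfl⟩
  | cons i α ih =>
    obtain ⟨hi, hα⟩ := not_or.1 (List.mem_cons.not.1 h0)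
    obtain ⟨β, rfl⟩ := ih hα
    obtain ⟨j, rfl⟩ := Fin.exists_succ_eq.2 (Ne.symm hi)
    exact ⟨j :: β, rfl⟩

/-- On the initial surface, the spatial derivatives of a net inherit the asymptotics of its
restriction to that surface. -/
lemma boundedToTimeOrder_zero_of_trace {U : Set (Fin 4 → ℝ)} (hU : IsOpen U)
    {K : Set (Fin 3 → ℝ)} (hK : K ⊆ timeZero ⁻¹' U) {Q : (ℝ → (Fin 4 → ℝ) → ℝ) → Prop}
    (hQ : IsModerateModule (timeZero '' K) Q) {g : ℝ → (Fin 4 → ℝ) → ℝ}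
    (hg : ∀ ε ∈ Ioc (0:ℝ) 1, ContDiffOn ℝ (⊤ : ℕ∞) (g ε) U) {v : ℝ → (Fin 3 → ℝ) → ℝ}
    (hv : ∀ ε ∈ Ioc (0:ℝ) 1, ∀ x ∈ timeZero ⁻¹' U, g ε (timeZero x) = v ε x)
    (hvQ : ∀ β : List (Fin 3), Q fun ε y => pds β (v ε) (Fin.tail y)) :
    BoundedToTimeOrder U Q 0 g := by
  refine ⟨hg, fun α hα => ?_⟩
  obtain ⟨β, rfl⟩ := exists_map_succ_of_zero_notMem α (List.count_eq_zero.1 (by omega))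
  refine hQ.congr ?_ (hvQ β)
  rintro ε hε _ ⟨x, hx, rfl⟩
  have htail : Fin.tail (timeZero x) = x := Fin.tail_cons (α := fun _ : Fin 4 => ℝ) 0 x
  rw [htail, ← pds_congr (hU.preimage continuous_timeZero) (hv ε hε) β (hK hx)]
  exact pds_comp_timeZero hU (hg ε hε) β (hK hx)

/-- Solutions of a second-order equation that is solved for the second time derivative, with
moderate coefficients, inherit the asymptotics of the initial data and of the source. -/
lemma boundedToTimeOrder_of_evolution {U E : Set (Fin 4 → ℝ)} (hU : IsOpen U) (hE : E ⊆ U)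
    {Q : (ℝ → (Fin 4 → ℝ) → ℝ) → Prop} (hQ : IsModerateModule E Q)
    {u F : ℝ → (Fin 4 → ℝ) → ℝ} {A : Fin 3 → ℝ → (Fin 4 → ℝ) → ℝ}
    {B : Fin 3 → Fin 3 → ℝ → (Fin 4 → ℝ) → ℝ} {D : Fin 4 → ℝ → (Fin 4 → ℝ) → ℝ}
    (hA : ∀ i s, BoundedToTimeOrder U (ModerateBound E) s (A i))
    (hB : ∀ i j s, BoundedToTimeOrder U (ModerateBound E) s (B i j))
    (hD : ∀ c s, BoundedToTimeOrder U (ModerateBound E) s (D c))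
    (hF : ∀ s, BoundedToTimeOrder U Q s F)
    (hu : BoundedToTimeOrder U Q 0 u) (hu' : BoundedToTimeOrder U Q 0 fun ε => pd 0 (u ε))
    (heq : ∀ ε ∈ Ioc (0:ℝ) 1, ∀ x ∈ U, pd 0 (pd 0 (u ε)) x =
      (∑ i, A i ε x * pd 0 (pd i.succ (u ε)) x)
        + (∑ i, ∑ j, B i j ε x * pd i.succ (pd j.succ (u ε)) x)
        + (∑ c, D c ε x * pd c (u ε) x) + F ε x) (s : ℕ) :
    BoundedToTimeOrder U Q s u := by
  suffices h : ∀ s, BoundedToTimeOrder U Q (s + 1) u from (h s).of_le (Nat.le_succ s)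
  intro s
  induction s with
  | zero => exact BoundedToTimeOrder.succ_of_pd_zero hU hE hQ hu hu'
  | succ s ih =>
    have ih₀ : BoundedToTimeOrder U Q s u := ih.of_le (Nat.le_succ s)
    refine .succ_of_pd_zero hU hE hQ hu (.succ_of_pd_zero hU hE hQ hu' ?_)
    have hpd : ∀ c : Fin 4, BoundedToTimeOrder U Q s fun ε => pd c (u ε) :=
      Fin.cases (ih.pd_zero hU) fun i => ih₀.pd_succ hU i
    have hR := ((BoundedToTimeOrder.sum hU hE hQ Finset.univ fun i =>
        BoundedToTimeOrder.mul hU hE hQ (hA i) ((ih.pd_succ hU i).pd_zero hU)).add hU hE hQ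
      (BoundedToTimeOrder.sum hU hE hQ Finset.univ fun i =>
        BoundedToTimeOrder.sum hU hE hQ Finset.univ fun j =>
          BoundedToTimeOrder.mul hU hE hQ (hB i j) ((ih₀.pd_succ hU j).pd_succ hU i))).add hU hE hQ
      (BoundedToTimeOrder.sum hU hE hQ Finset.univ fun c =>
        BoundedToTimeOrder.mul hU hE hQ (hD c) (hpd c)) |>.add hU hE hQ (hF s)
    refine ⟨fun ε hε => ((hu.1 ε hε).pd hU 0).pd hU 0, fun α hα => ?_⟩
    exact hQ.congr (fun ε hε x hx => (pds_congr hU (heq ε hε) α (hE hx)).symm) (hR.2 α hα)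

/-- Bounds on initial energies from initial data, in coordinates: for the wave equation of
the metric `g_ε = -V_ε² dt² + h^ε_{ij}(dx^i - N^i_ε dt)(dx^j - N^j_ε dt)` subject to the
asymptotic conditions (i)-(iv), moderate (resp. negligible) data produce moderate
(resp. negligible) traces of all derivatives of the solution on the initial surface. -/
theorem initial_traces_moderate_resp_negligible
    (U : Set (Fin 4 → ℝ)) (hU : IsOpen U)
    (S : Set (Fin 3 → ℝ)) (hS : S = {x | timeZero x ∈ U})
    (hSne : S.Nonempty) (hSopen : IsOpen S)
    (V : ℝ → (Fin 4 → ℝ) → ℝ) (N : ℝ → Fin 3 → (Fin 4 → ℝ) → ℝ)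
    (h : ℝ → Fin 3 → Fin 3 → (Fin 4 → ℝ) → ℝ) (b : ℝ → Fin 4 → (Fin 4 → ℝ) → ℝ)
    (hVpos : ∀ ε ∈ Ioc (0:ℝ) 1, ∀ x ∈ U, 0 < V ε x)
    (hsmooth : ∀ ε ∈ Ioc (0:ℝ) 1, ContDiffOn ℝ (⊤ : ℕ∞) (V ε) U ∧
      (∀ i, ContDiffOn ℝ (⊤ : ℕ∞) (N ε i) U) ∧ (∀ i j, ContDiffOn ℝ (⊤ : ℕ∞) (h ε i j) U) ∧
      (∀ c, ContDiffOn ℝ (⊤ : ℕ∞) (b ε c) U))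
    (hsym : ∀ ε ∈ Ioc (0:ℝ) 1, ∀ i j, ∀ x ∈ U, h ε i j x = h ε j i x)
    -- (i) zeroth-order bounds O(1)
    (hO1 : ∀ K ⊆ U, IsCompact K → ∃ C > (0:ℝ), ∃ ε₀ > (0:ℝ),
      ∀ ε : ℝ, 0 < ε → ε < ε₀ → ∀ x ∈ K,
        |V ε x| ≤ C ∧ (∀ i, |N ε i x| ≤ C) ∧ (∀ i j, |h ε i j x| ≤ C))
    -- (ii) first derivatives of V are O(1)
    (hdV : ∀ K ⊆ U, IsCompact K → ∃ C > (0:ℝ), ∃ ε₀ > (0:ℝ),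
      ∀ ε : ℝ, 0 < ε → ε < ε₀ → ∀ x ∈ K, ∀ a : Fin 4, |pd a (V ε) x| ≤ C)
    -- (iii) higher derivatives: O(ε^{-|α|}) for V, N, h and O(ε^{-1-|α|}) for b
    (hhigher : ∀ K ⊆ U, IsCompact K → ∀ α : List (Fin 4), ∃ C > (0:ℝ), ∃ ε₀ > (0:ℝ),
      ∀ ε : ℝ, 0 < ε → ε < ε₀ → ∀ x ∈ K,
        |pds α (V ε) x| ≤ C * ε⁻¹ ^ α.length ∧
        (∀ i, |pds α (N ε i) x| ≤ C * ε⁻¹ ^ α.length) ∧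
        (∀ i j, |pds α (h ε i j) x| ≤ C * ε⁻¹ ^ α.length) ∧
        (∀ c, |pds α (b ε c) x| ≤ C * ε⁻¹ ^ (α.length + 1)))
    -- (iv) uniform two-sided bounds on V
    (hVbound : ∀ K ⊆ U, IsCompact K → ∃ M₀ ≥ (1:ℝ), ∃ ε₀ > (0:ℝ),
      ∀ ε : ℝ, 0 < ε → ε < ε₀ → ∀ x ∈ K, 1 / M₀ ≤ V ε x ∧ V ε x ≤ M₀)
    -- the right-hand side
    (f : ℝ → (Fin 4 → ℝ) → ℝ) (hf : ModerateOn U f)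
    (hfsmooth : ∀ ε ∈ Ioc (0:ℝ) 1, ContDiffOn ℝ (⊤ : ℕ∞) (f ε) U)
    -- the solutions
    (u : ℝ → (Fin 4 → ℝ) → ℝ)
    (husmooth : ∀ ε ∈ Ioc (0:ℝ) 1, ContDiffOn ℝ (⊤ : ℕ∞) (u ε) U)
    (hPDE : ∀ ε ∈ Ioc (0:ℝ) 1, ∀ x ∈ U,
      -((V ε x)⁻¹ ^ 2) * pd 0 (pd 0 (u ε)) x
        - 2 * (V ε x)⁻¹ ^ 2 * (∑ i, N ε i x * pd 0 (pd i.succ (u ε)) x)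
        + (∑ i, ∑ j, (h ε i j x - (V ε x)⁻¹ ^ 2 * N ε i x * N ε j x)
            * pd i.succ (pd j.succ (u ε)) x)
        + (∑ c, b ε c x * pd c (u ε) x) = f ε x)
    -- the initial data
    (v w : ℝ → (Fin 3 → ℝ) → ℝ)
    (hdata : ∀ ε ∈ Ioc (0:ℝ) 1, ∀ x ∈ S,
      u ε (timeZero x) = v ε x ∧ pd 0 (u ε) (timeZero x) = w ε x) :
    ((ModerateOn S v ∧ ModerateOn S w) →
      ∀ (s : ℕ) (β : List (Fin 3)),
        ModerateOn S (fun ε x =>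
          pds (List.replicate s 0 ++ β.map Fin.succ) (u ε) (timeZero x))) ∧
    ((NegligibleOn S v ∧ NegligibleOn S w ∧ NegligibleOn U f) →
      ∀ (s : ℕ) (β : List (Fin 3)),
        NegligibleOn S (fun ε x =>
          pds (List.replicate s 0 ++ β.map Fin.succ) (u ε) (timeZero x))) := by
  have hSU : S = timeZero ⁻¹' U := hS
  have key : ∀ K ⊆ S, IsCompact K → ∀ Q : (ℝ → (Fin 4 → ℝ) → ℝ) → Prop,
      IsModerateModule (timeZero '' K) Q →
      (∀ α, Q fun ε => pds α (f ε)) →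
      (∀ β : List (Fin 3), Q fun ε y => pds β (v ε) (Fin.tail y)) →
      (∀ β : List (Fin 3), Q fun ε y => pds β (w ε) (Fin.tail y)) →
      ∀ α, Q fun ε => pds α (u ε) := by
    intro K hKS hK Q hQ hfQ hvQ hwQ α
    have hKU : K ⊆ timeZero ⁻¹' U := hSU ▸ hKS
    have hE : timeZero '' K ⊆ U := image_subset_iff.2 hKU
    have hEc : IsCompact (timeZero '' K) := hK.image continuous_timeZero
    have hM := isModerateModule_moderateBound (timeZero '' K)
    have hVc : ∀ s, BoundedToTimeOrder U (ModerateBound (timeZero '' K)) s V := fun s =>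
      ⟨fun ε hε => (hsmooth ε hε).1, fun α _ => by
        obtain ⟨C, hC, ε₀, hε₀, hb⟩ := hhigher _ hE hEc α
        exact ⟨_, C, hC, ε₀, hε₀, fun ε h0 h1 x hx => (hb ε h0 h1 x hx).1⟩⟩
    have hNc : ∀ i s, BoundedToTimeOrder U (ModerateBound (timeZero '' K)) s
        fun ε => N ε i := fun i s =>
      ⟨fun ε hε => (hsmooth ε hε).2.1 i, fun α _ => by
        obtain ⟨C, hC, ε₀, hε₀, hb⟩ := hhigher _ hE hEc α
        exact ⟨_, C, hC, ε₀, hε₀, fun ε h0 h1 x hx => (hb ε h0 h1 x hx).2.1 i⟩⟩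
    have hhc : ∀ i j s, BoundedToTimeOrder U (ModerateBound (timeZero '' K)) s
        fun ε => h ε i j := fun i j s =>
      ⟨fun ε hε => (hsmooth ε hε).2.2.1 i j, fun α _ => by
        obtain ⟨C, hC, ε₀, hε₀, hb⟩ := hhigher _ hE hEc α
        exact ⟨_, C, hC, ε₀, hε₀, fun ε h0 h1 x hx => (hb ε h0 h1 x hx).2.2.1 i j⟩⟩
    have hbc : ∀ c s, BoundedToTimeOrder U (ModerateBound (timeZero '' K)) s
        fun ε => b ε c := fun c s =>
      ⟨fun ε hε => (hsmooth ε hε).2.2.2 c, fun α _ => by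
        obtain ⟨C, hC, ε₀, hε₀, hb⟩ := hhigher _ hE hEc α
        exact ⟨_, C, hC, ε₀, hε₀, fun ε h0 h1 x hx => (hb ε h0 h1 x hx).2.2.2 c⟩⟩
    have hconst : ∀ (c : ℝ) (s : ℕ), BoundedToTimeOrder U (ModerateBound (timeZero '' K)) s
        fun _ _ => c := fun c s =>
      .const hM c ⟨0, |c| + 1, by positivity, 1, one_pos, fun _ _ _ _ _ => by simp⟩
    have hV2 : ∀ s, BoundedToTimeOrder U (ModerateBound (timeZero '' K)) s
        fun ε x => V ε x * V ε x := fun s => .mul hU hE hM hVc (hVc s)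
    have hmV2 : ∀ s, BoundedToTimeOrder U (ModerateBound (timeZero '' K)) s
        fun ε x => (-1) * (V ε x * V ε x) := fun s => .mul hU hE hM (hconst (-1)) (hV2 s)
    have hmN : ∀ i s, BoundedToTimeOrder U (ModerateBound (timeZero '' K)) s
        fun ε x => (-1) * N ε i x := fun i s => .mul hU hE hM (hconst (-1)) (hNc i s)
    refine (boundedToTimeOrder_of_evolution hU hE hQ
      (A := fun i ε x => (-2) * N ε i x)
      (B := fun i j ε x => V ε x * V ε x * h ε i j x + (-1) * N ε i x * N ε j x)
      (D := fun c ε x => V ε x * V ε x * b ε c x)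
      (F := fun ε x => (-1) * (V ε x * V ε x) * f ε x)
      (fun i s => .mul hU hE hM (hconst (-2)) (hNc i s))
      (fun i j s => (BoundedToTimeOrder.mul hU hE hM hV2 (hhc i j s)).add hU hE hM
        (.mul hU hE hM (hmN i) (hNc j s)))
      (fun c s => .mul hU hE hM hV2 (hbc c s))
      (fun s => .mul hU hE hQ hmV2 ⟨hfsmooth, fun α _ => hfQ α⟩)
      (boundedToTimeOrder_zero_of_trace hU hKU hQ husmooth
        (fun ε hε x hx => (hdata ε hε x (hSU ▸ hx)).1) hvQ)
      (boundedToTimeOrder_zero_of_trace hU hKU hQ (fun ε hε => (husmooth ε hε).pd hU 0)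
        (fun ε hε x hx => (hdata ε hε x (hSU ▸ hx)).2) hwQ)
      ?_ (α.count 0)).2 α le_rfl
    intro ε hε x hx
    have hV0 : V ε x ≠ 0 := (hVpos ε hε x hx).ne'
    rw [← hPDE ε hε x hx]
    simp only [Fin.sum_univ_succ, Fin.sum_univ_zero]
    field_simp
    ring
  have restrict : ∀ ε ∈ Ioc (0:ℝ) 1, ∀ (α : List (Fin 4)) (γ : List (Fin 3)), ∀ x ∈ S,
      pds γ (fun x => pds α (u ε) (timeZero x)) x
        = pds (γ.map Fin.succ ++ α) (u ε) (timeZero x) := by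
    intro ε hε α γ x hx
    rw [pds_comp_timeZero hU ((husmooth ε hε).pds hU α) γ (hSU ▸ hx), pds_append]
  have htail : ∀ x : Fin 3 → ℝ, Fin.tail (timeZero x) = x :=
    Fin.tail_cons (α := fun _ : Fin 4 => ℝ) 0
  constructor
  · rintro ⟨hv, hw⟩ s β K hKS hK γ
    have hE : timeZero '' K ⊆ U := image_subset_iff.2 (hSU ▸ hKS)
    refine (isModerateModule_moderateBound K).congr
      (fun ε hε x hx => (restrict ε hε _ γ x (hKS hx)).symm) ?_
    obtain ⟨n, C, hC, ε₀, hε₀, hb⟩ := key K hKS hK _ (isModerateModule_moderateBound _)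
      (hf _ hE (hK.image continuous_timeZero))
      (fun β => by simpa [ModerateBound, htail] using hv K hKS hK β)
      (fun β => by simpa [ModerateBound, htail] using hw K hKS hK β)
      (γ.map Fin.succ ++ (List.replicate s 0 ++ β.map Fin.succ))
    exact ⟨n, C, hC, ε₀, hε₀, fun ε h0 h1 x hx => hb ε h0 h1 _ (mem_image_of_mem _ hx)⟩
  · rintro ⟨hv, hw, hfn⟩ s β K hKS hK γ
    have hE : timeZero '' K ⊆ U := image_subset_iff.2 (hSU ▸ hKS)
    refine (isModerateModule_negligibleBound K).congr
      (fun ε hε x hx => (restrict ε hε _ γ x (hKS hx)).symm) fun q => ?_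
    obtain ⟨C, hC, ε₀, hε₀, hb⟩ := key K hKS hK _ (isModerateModule_negligibleBound _)
      (hfn _ hE (hK.image continuous_timeZero))
      (fun β => by simpa [NegligibleBound, htail] using hv K hKS hK β)
      (fun β => by simpa [NegligibleBound, htail] using hw K hKS hK β)
      (γ.map Fin.succ ++ (List.replicate s 0 ++ β.map Fin.succ)) q
    exact ⟨C, hC, ε₀, hε₀, fun ε h0 h1 x hx => hb ε h0 h1 _ (mem_image_of_mem _ hx)⟩
end

section
/- Let (r_ε)_{ε∈(0,1]} be a moderate net of real numbers. Then the following are equivalent: (i) there exists a moderate net (s_ε)_{ε∈(0,1]} of real numbers such that the net (r_ε s_ε − 1)_ε is negligible; (ii) there exist m ∈ ℕ and ε₀ > 0 such that |r_ε| ≥ ε^m for all ε < ε₀. -/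
/-- A net of real numbers `(r ε)` is moderate if `|r ε| = O(ε^{-N})` as `ε → 0⁺` for some `N`. -/
def ModerateNet (r : ℝ → ℝ) : Prop :=
  ∃ N : ℕ, ∃ C > (0:ℝ), ∃ ε₀ > (0:ℝ), ∀ ε : ℝ, 0 < ε → ε < ε₀ → |r ε| ≤ C * ε⁻¹ ^ N

/-- A net of real numbers `(r ε)` is negligible if `|r ε| = O(ε^q)` as `ε → 0⁺` for every `q`. -/
def NegligibleNet (r : ℝ → ℝ) : Prop :=
  ∀ q : ℕ, ∃ C > (0:ℝ), ∃ ε₀ > (0:ℝ), ∀ ε : ℝ, 0 < ε → ε < ε₀ → |r ε| ≤ C * ε ^ q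

/-- A moderate net of reals is invertible in the ring of generalised numbers iff it is
strictly nonzero, i.e. bounded below by some fixed power `ε^m` for small `ε`. -/
theorem generalised_number_invertible_iff_strictly_nonzero
    (r : ℝ → ℝ) (hr : ModerateNet r) :
    (∃ s : ℝ → ℝ, ModerateNet s ∧ NegligibleNet (fun ε => r ε * s ε - 1)) ↔
    (∃ m : ℕ, ∃ ε₀ > (0:ℝ), ∀ ε : ℝ, 0 < ε → ε < ε₀ → ε ^ m ≤ |r ε|) := by
  constructor
  · rintro ⟨s, ⟨N, C, hC, ε₁, hε₁, hs⟩, hn⟩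
    obtain ⟨D, hD, ε₂, hε₂, hrs⟩ := hn 1
    refine ⟨N + 1, min (min ε₁ ε₂) (min (1 / (2 * C)) (1 / (2 * D))), by positivity, ?_⟩
    intro ε hε hlt
    simp only [lt_min_iff] at hlt
    obtain ⟨⟨h₁, h₂⟩, h₃, h₄⟩ := hlt
    rw [lt_div_iff₀ (by positivity)] at h₃ h₄
    have hprod := hrs ε hε h₂
    have hhalf : 1 / 2 ≤ |r ε| * |s ε| := by
      rw [← abs_mul]
      have := (abs_le.mp hprod).1
      have := le_abs_self (r ε * s ε)
      linarith
    have hbound : 1 / 2 ≤ |r ε| * (C * ε⁻¹ ^ N) :=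
      hhalf.trans (mul_le_mul_of_nonneg_left (hs ε hε h₁) (abs_nonneg _))
    have hpow : ε ^ N / 2 ≤ |r ε| * C := by
      have := mul_le_mul_of_nonneg_left hbound (pow_pos hε N).le
      have hcancel : ε ^ N * (|r ε| * (C * ε⁻¹ ^ N)) = |r ε| * C := by
        rw [inv_pow]
        field_simp
      linarith
    refine le_of_mul_le_mul_right (le_trans ?_ hpow) hC
    rw [pow_succ]
    nlinarith [pow_pos hε N]
  · rintro ⟨m, ε₀, hε₀, h⟩
    refine ⟨fun ε => (r ε)⁻¹, ⟨m, 1, one_pos, ε₀, hε₀, fun ε hε hlt => ?_⟩,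
      fun q => ⟨1, one_pos, ε₀, hε₀, fun ε hε hlt => ?_⟩⟩
    · rw [abs_inv, one_mul, inv_pow]
      exact inv_anti₀ (pow_pos hε m) (h ε hε hlt)
    · have hne : r ε ≠ 0 := abs_pos.mp ((pow_pos hε m).trans_le (h ε hε hlt))
      simp only [mul_inv_cancel₀ hne, sub_self, abs_zero]
      positivity
end

section
/- Let γ > 0 and C > 0. For each ε ∈ (0,1/2] let E_ε : [0,γ] → [0,∞) be continuous and let a_ε ≥ 0 be real numbers such that for all τ ∈ [0,γ]: E_ε(τ) ≤ a_ε + C · log(1/ε) · ∫₀^τ E_ε(ζ) dζ. If the net (a_ε)_ε is moderate, then the net (sup_{τ∈[0,γ]} E_ε(τ))_ε is moderate; if (a_ε)_ε is negligible, then (sup_{τ∈[0,γ]} E_ε(τ))_ε is negligible. -/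
open Set MeasureTheory

/-- **Grönwall's inequality**, integral form, with constant coefficients. -/
theorem le_mul_exp_of_le_add_mul_integral {f : ℝ → ℝ} {a K T : ℝ} (hT : 0 ≤ T) (hK : 0 ≤ K)
    (hf : ContinuousOn f (Icc 0 T)) (hf0 : ∀ t ∈ Icc 0 T, 0 ≤ f t)
    (h : ∀ t ∈ Icc 0 T, f t ≤ a + K * ∫ s in (0:ℝ)..t, f s) :
    ∀ t ∈ Icc 0 T, f t ≤ a * Real.exp (K * t) := by
  set g : ℝ → ℝ := IccExtend hT ((Icc 0 T).domRestrict f)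
  have hg : Continuous g := hf.domRestrict.Icc_extend'
  have hgf : ∀ t ∈ Icc 0 T, g t = f t := fun t ht => IccExtend_of_mem hT _ ht
  have hint : ∀ t ∈ Icc 0 T, ∫ s in (0:ℝ)..t, f s = ∫ s in (0:ℝ)..t, g s := by
    intro t ht
    refine intervalIntegral.integral_congr fun s hs => ?_
    rw [uIcc_of_le ht.1] at hs
    exact (hgf s ⟨hs.1, hs.2.trans ht.2⟩).symm
  have hF : ∀ t ∈ Icc 0 T, f t ≤ a + K * ∫ s in (0:ℝ)..t, g s := fun t ht =>
    hint t ht ▸ h t ht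
  have hderiv : ∀ t, HasDerivAt (fun t => a + K * ∫ s in (0:ℝ)..t, g s) (K * g t) t := fun t =>
    ((hg.integral_hasStrictDerivAt 0 t).hasDerivAt.const_mul K).const_add a
  have ha : 0 ≤ a := by
    have h0 : (0:ℝ) ∈ Icc 0 T := left_mem_Icc.2 hT
    simpa using (hf0 0 h0).trans (h 0 h0)
  have key := norm_le_gronwallBound_of_norm_deriv_right_le (δ := a) (K := K) (ε := 0)
    (a := 0) (b := T) (fun t _ => (hderiv t).continuousAt.continuousWithinAt)
    (fun t _ => (hderiv t).hasDerivWithinAt) (by simp [abs_of_nonneg ha]) (by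
      intro t ht
      have ht' := Ico_subset_Icc_self ht
      rw [hgf t ht', add_zero, norm_mul, Real.norm_of_nonneg hK, Real.norm_of_nonneg (hf0 t ht')]
      exact mul_le_mul_of_nonneg_left ((hF t ht').trans (le_abs_self _)) hK)
  intro t ht
  have hb := key t ht
  rw [gronwallBound_ε0, sub_zero] at hb
  exact (hF t ht).trans ((le_abs_self _).trans hb)

/-- If `|s ε| ≤ |r ε| * ε⁻¹ ^ M` for small `ε` and `r` is moderate, then so is `s`. -/
theorem ModerateNet.of_abs_le_mul_inv_pow {r s : ℝ → ℝ} (hr : ModerateNet r) {M : ℕ} {ε₁ : ℝ}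
    (hε₁ : 0 < ε₁) (h : ∀ ε, 0 < ε → ε < ε₁ → |s ε| ≤ |r ε| * ε⁻¹ ^ M) : ModerateNet s := by
  obtain ⟨N, A, hA, ε₀, hε₀, hr⟩ := hr
  refine ⟨N + M, A, hA, min ε₀ ε₁, lt_min hε₀ hε₁, fun ε hε hlt => ?_⟩
  obtain ⟨h0, h1⟩ := lt_min_iff.1 hlt
  calc |s ε| ≤ |r ε| * ε⁻¹ ^ M := h ε hε h1
    _ ≤ A * ε⁻¹ ^ N * ε⁻¹ ^ M := by gcongr; exact hr ε hε h0
    _ = A * ε⁻¹ ^ (N + M) := by ring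

/-- If `|s ε| ≤ |r ε| * ε⁻¹ ^ M` for small `ε` and `r` is negligible, then so is `s`. -/
theorem NegligibleNet.of_abs_le_mul_inv_pow {r s : ℝ → ℝ} (hr : NegligibleNet r) {M : ℕ} {ε₁ : ℝ}
    (hε₁ : 0 < ε₁) (h : ∀ ε, 0 < ε → ε < ε₁ → |s ε| ≤ |r ε| * ε⁻¹ ^ M) : NegligibleNet s := by
  intro q
  obtain ⟨A, hA, ε₀, hε₀, hr⟩ := hr (q + M)
  refine ⟨A, hA, min ε₀ ε₁, lt_min hε₀ hε₁, fun ε hε hlt => ?_⟩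
  obtain ⟨h0, h1⟩ := lt_min_iff.1 hlt
  calc |s ε| ≤ |r ε| * ε⁻¹ ^ M := h ε hε h1
    _ ≤ A * ε ^ (q + M) * ε⁻¹ ^ M := by gcongr; exact hr ε hε h0
    _ = A * ε ^ q := by
      rw [pow_add, ← mul_assoc, mul_assoc, ← mul_pow, mul_inv_cancel₀ hε.ne', one_pow, mul_one]

/-- The Gronwall argument still yields moderateness resp. negligibility when the constant
in the energy inequality is allowed to grow like `C log(1/ε)`, since
`e^{C log(1/ε) γ} = ε^{-Cγ}` is itself a moderate factor. -/
theorem gronwall_log_factor (γ C : ℝ) (hγ : 0 < γ) (hC : 0 < C)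
    (E : ℝ → ℝ → ℝ) (a : ℝ → ℝ)
    (hEcont : ∀ ε ∈ Ioc (0:ℝ) (1/2), ContinuousOn (E ε) (Icc 0 γ))
    (hEnn : ∀ ε ∈ Ioc (0:ℝ) (1/2), ∀ τ ∈ Icc (0:ℝ) γ, 0 ≤ E ε τ)
    (hann : ∀ ε ∈ Ioc (0:ℝ) (1/2), 0 ≤ a ε)
    (hineq : ∀ ε ∈ Ioc (0:ℝ) (1/2), ∀ τ ∈ Icc (0:ℝ) γ,
      E ε τ ≤ a ε + C * Real.log (1/ε) * ∫ ζ in (0:ℝ)..τ, E ε ζ) :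
    (ModerateNet a → ModerateNet (fun ε => sSup (E ε '' Icc 0 γ))) ∧
    (NegligibleNet a → NegligibleNet (fun ε => sSup (E ε '' Icc 0 γ))) := by
  have bound : ∀ ε, 0 < ε → ε < 1 / 2 →
      |sSup (E ε '' Icc 0 γ)| ≤ |a ε| * ε⁻¹ ^ ⌈C * γ⌉₊ := by
    intro ε hε hlt
    have hmem : ε ∈ Ioc (0:ℝ) (1/2) := ⟨hε, hlt.le⟩
    have hlog : 0 ≤ Real.log (1 / ε) := Real.log_nonneg (by rw [le_div_iff₀ hε]; linarith)
    have hexp : ∀ τ ∈ Icc 0 γ, Real.exp (C * Real.log (1 / ε) * τ) ≤ ε⁻¹ ^ ⌈C * γ⌉₊ := by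
      intro τ hτ
      rw [← Real.exp_log (inv_pos.2 hε), ← Real.exp_nat_mul, Real.exp_le_exp, ← one_div,
        mul_right_comm]
      exact mul_le_mul_of_nonneg_right
        ((mul_le_mul_of_nonneg_left hτ.2 hC.le).trans (Nat.le_ceil _)) hlog
    rw [abs_of_nonneg (hann ε hmem), abs_of_nonneg (Real.sSup_nonneg
      (forall_mem_image.2 (hEnn ε hmem)))]
    refine csSup_le ((nonempty_Icc.2 hγ.le).image _) (forall_mem_image.2 fun τ hτ => ?_)
    exact (le_mul_exp_of_le_add_mul_integral hγ.le (mul_nonneg hC.le hlog) (hEcont ε hmem)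
      (hEnn ε hmem) (hineq ε hmem) τ hτ).trans
        (mul_le_mul_of_nonneg_left (hexp τ hτ) (hann ε hmem))
  exact ⟨fun h => h.of_abs_le_mul_inv_pow one_half_pos bound,
    fun h => h.of_abs_le_mul_inv_pow one_half_pos bound⟩
end
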